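/- Let p ∈ S², a ∈ ℝ³, let (r_i) be a sequence in (0,1) with r_i → 1, let (p_i) be a sequence in S² with p_i → p, and let (a_i) be a sequence in ℝ³ with a_i → a. Then ∫_{S²} |φ_{r_i p_i}(x) + a_i − x|² dσ(x) → 4π(|p + a|² + 1) as i → ∞; in particular the limit is at least 4π. -/

import Mathlib

open MeasureTheory RealInnerProductSpace Real Filter

noncomputable section

abbrev E3 := EuclideanSpace ℝ (Fin 3)

/-- The standard surface measure `σ` on `S² ⊂ ℝ³`, with `σ(S²) = 4π`. -/
def sphMeasure : Measure (Metric.sphere (0 : E3) 1) := volume.toSphere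

/-- The Möbius transformation `φ_v(x) = ((1 − |v|²)x + 2(1 + v·x)v)/(1 + |v|² + 2 v·x)`. -/
def mob (v x : E3) : E3 :=
  (1 + ‖v‖ ^ 2 + 2 * ⟪v, x⟫)⁻¹ • ((1 - ‖v‖ ^ 2) • x + (2 * (1 + ⟪v, x⟫)) • v)

/-- Möbius transformations of the ball parameter `v` preserve the unit sphere. -/
lemma norm_mob_eq_one {v x : E3} (hv : ‖v‖ < 1) (hx : ‖x‖ = 1) : ‖mob v x‖ = 1 := by
  have h1 : |⟪v, x⟫| ≤ ‖v‖ := by simpa [hx] using abs_real_inner_le_norm v x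
  have h2 := (abs_le.1 h1).1
  have hD : 0 < 1 + ‖v‖ ^ 2 + 2 * ⟪v, x⟫ := by nlinarith [sq_nonneg (1 - ‖v‖)]
  have hN : ‖(1 - ‖v‖ ^ 2) • x + (2 * (1 + ⟪v, x⟫)) • v‖ = 1 + ‖v‖ ^ 2 + 2 * ⟪v, x⟫ := by
    rw [← sq_eq_sq₀ (norm_nonneg _) hD.le, norm_add_sq_real, real_inner_smul_left,
      real_inner_smul_right, real_inner_comm v x, norm_smul, norm_smul, mul_pow, mul_pow, hx,
      Real.norm_eq_abs, Real.norm_eq_abs, sq_abs, sq_abs]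
    ring
  rw [mob, norm_smul, hN, norm_inv, Real.norm_of_nonneg hD.le, inv_mul_cancel₀ hD.ne']

/-- If `v → p ∈ S²`, then `mob v x → p` for every `x ∈ S²` other than `-p`. -/
lemma tendsto_mob {ι : Type*} {l : Filter ι} {v : ι → E3} {p x : E3} (hp : ‖p‖ = 1)
    (hx : ‖x‖ = 1) (hxp : x ≠ -p) (hv : Tendsto v l (nhds p)) :
    Tendsto (fun i => mob (v i) x) l (nhds p) := by
  have hne : 1 + ⟪p, x⟫ ≠ 0 := by
    intro h
    apply hxp
    have h' : ‖x + p‖ ^ 2 = 0 := by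
      rw [norm_add_sq_real, hp, hx, real_inner_comm]
      linarith
    exact eq_neg_of_add_eq_zero_left (by simpa using h')
  have hD : 1 + ‖p‖ ^ 2 + 2 * ⟪p, x⟫ ≠ 0 := by
    rw [hp]
    intro h
    apply hne
    linarith
  have hc : ContinuousAt (fun w => mob w x) p := by
    have hDc : ContinuousAt (fun w : E3 => 1 + ‖w‖ ^ 2 + 2 * ⟪w, x⟫) p := by fun_prop
    unfold mob
    exact (hDc.inv₀ hD).smul (by fun_prop)
  have hval : mob p x = p := by
    have h2 : 1 + (1 : ℝ) ^ 2 + 2 * ⟪p, x⟫ = 2 * (1 + ⟪p, x⟫) := by ring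
    rw [mob, hp, h2]
    simp only [one_pow, sub_self, zero_smul, zero_add]
    exact inv_smul_smul₀ (mul_ne_zero two_ne_zero hne) p
  have hlim : Tendsto (fun w => mob w x) (nhds p) (nhds p) := by
    simpa only [ContinuousAt, hval] using hc
  exact hlim.comp hv

instance : IsFiniteMeasure sphMeasure := inferInstanceAs (IsFiniteMeasure (volume.toSphere))

lemma sphMeasure_real_univ : sphMeasure.real Set.univ = 4 * π := by
  rw [sphMeasure, Measure.toSphere_real_apply_univ, measureReal_def,
    EuclideanSpace.volume_ball_fin_three]
  simp only [finrank_euclideanSpace, Fintype.card_fin, ENNReal.ofReal_one, one_pow, one_mul]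
  rw [ENNReal.toReal_ofReal (by positivity)]
  push_cast
  ring

lemma sphMeasure_singleton (q : Metric.sphere (0 : E3) 1) : sphMeasure {q} = 0 := by
  rw [sphMeasure, Measure.toSphere_apply' _ (measurableSet_singleton q)]
  refine mul_eq_zero_of_right _ (measure_mono_null (t := (ℝ ∙ (q : E3) : Submodule ℝ E3)) ?_ ?_)
  · rintro _ ⟨c, -, _, ⟨y, rfl, rfl⟩, rfl⟩
    exact Submodule.smul_mem _ c (Submodule.mem_span_singleton_self _)
  · refine Measure.addHaar_submodule _ _ fun h => ?_
    have h1 := finrank_span_le_card (R := ℝ) ({(q : E3)} : Set E3)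
    rw [h, finrank_top] at h1
    simp at h1

open scoped Pointwise in
lemma measurePreserving_neg_sphMeasure :
    MeasurePreserving (fun x : Metric.sphere (0 : E3) 1 => -x) sphMeasure sphMeasure := by
  have hm : Measurable (fun x : Metric.sphere (0 : E3) 1 => -x) := continuous_neg.measurable
  refine ⟨hm, ?_⟩
  ext s hs
  rw [Measure.map_apply hm hs, sphMeasure, Measure.toSphere_apply' _ (hm hs),
    Measure.toSphere_apply' _ hs, ← Measure.measure_neg volume (Set.Ioo (0 : ℝ) 1 • _)]
  congr 2
  rw [← Set.smul_neg]
  congr 1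
  ext y
  constructor
  · rintro ⟨x, hx, hxy⟩
    exact ⟨-x, hx, by simp [hxy]⟩
  · rintro ⟨x, hx, rfl⟩
    exact ⟨-x, by simpa using hx, by simp⟩

lemma integral_inner_sphMeasure (c : E3) :
    ∫ x : Metric.sphere (0 : E3) 1, ⟪c, (x : E3)⟫ ∂sphMeasure = 0 := by
  have h := measurePreserving_neg_sphMeasure.integral_comp
    (Homeomorph.neg _).measurableEmbedding
    (fun x : Metric.sphere (0 : E3) 1 => ⟪c, (x : E3)⟫)
  simp_rw [coe_neg_sphere, inner_neg_right, integral_neg] at h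
  linarith

lemma integral_norm_sub_sq_sphMeasure (c : E3) :
    ∫ x : Metric.sphere (0 : E3) 1, ‖c - (x : E3)‖ ^ 2 ∂sphMeasure
      = 4 * π * (‖c‖ ^ 2 + 1) := by
  have hi : Integrable (fun x : Metric.sphere (0 : E3) 1 => 2 * ⟪c, (x : E3)⟫) sphMeasure :=
    Integrable.of_bound (by fun_prop) (2 * ‖c‖) <| .of_forall fun x => by
      simpa using abs_real_inner_le_norm c (x : E3)
  have h (x : Metric.sphere (0 : E3) 1) :
      ‖c - (x : E3)‖ ^ 2 = (‖c‖ ^ 2 + 1) - 2 * ⟪c, (x : E3)⟫ := by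
    rw [norm_sub_sq_real, norm_eq_of_mem_sphere]
    ring
  simp_rw [h]
  rw [integral_sub (integrable_const _) hi, integral_const, integral_const_mul,
    integral_inner_sphMeasure, sphMeasure_real_univ, smul_eq_mul]
  ring

/-- the normalization functional degenerates to the value
`4π(|p + a|² + 1) ≥ 4π` along sequences of Möbius transformations with `|v| → 1`. -/
theorem stmt11 (p : E3) (hp : p ∈ Metric.sphere (0 : E3) 1) (a : E3)
    (r : ℕ → ℝ) (hr : ∀ i, r i ∈ Set.Ioo (0 : ℝ) 1) (hrlim : Tendsto r atTop (nhds 1))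
    (ps : ℕ → E3) (hps : ∀ i, ps i ∈ Metric.sphere (0 : E3) 1)
    (hplim : Tendsto ps atTop (nhds p))
    (as : ℕ → E3) (halim : Tendsto as atTop (nhds a)) :
    Tendsto
      (fun i => ∫ x : Metric.sphere (0 : E3) 1,
        ‖mob (r i • ps i) (x : E3) + as i - (x : E3)‖ ^ 2 ∂sphMeasure)
      atTop (nhds (4 * π * (‖p + a‖ ^ 2 + 1))) ∧
    4 * π ≤ 4 * π * (‖p + a‖ ^ 2 + 1) := by
  have hp' : ‖p‖ = 1 := by simpa using hp
  refine ⟨?_, by nlinarith [mul_nonneg pi_pos.le (sq_nonneg ‖p + a‖)]⟩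
  rw [← integral_norm_sub_sq_sphMeasure]
  obtain ⟨C, hC⟩ := halim.norm.bddAbove_range
  have hCi (i : ℕ) : ‖as i‖ ≤ C := hC ⟨i, rfl⟩
  have hv (i : ℕ) : ‖r i • ps i‖ < 1 := by
    rw [norm_smul, mem_sphere_zero_iff_norm.1 (hps i), mul_one, Real.norm_of_nonneg (hr i).1.le]
    exact (hr i).2
  have hvlim : Tendsto (fun i => r i • ps i) atTop (nhds p) := by
    simpa using hrlim.smul hplim
  refine tendsto_integral_of_dominated_convergence (fun _ => (1 + C + 1) ^ 2) ?_
    (integrable_const _) ?_ ?_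
  · intro i
    unfold mob
    exact Measurable.aestronglyMeasurable (by fun_prop)
  · refine fun i => .of_forall fun x => ?_
    rw [norm_pow, norm_norm]
    gcongr
    calc ‖mob (r i • ps i) x + as i - x‖
        ≤ ‖mob (r i • ps i) x‖ + ‖as i‖ + ‖(x : E3)‖ :=
          (norm_sub_le _ _).trans (add_le_add_left (norm_add_le _ _) _)
      _ ≤ 1 + C + 1 := by
          rw [norm_mob_eq_one (hv i) (norm_eq_of_mem_sphere x), norm_eq_of_mem_sphere]
          gcongr
          exact hCi i
  · have hae : ∀ᵐ x ∂sphMeasure, x ≠ -(⟨p, hp⟩ : Metric.sphere (0 : E3) 1) :=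
      measure_eq_zero_iff_ae_notMem.1 (sphMeasure_singleton _)
    filter_upwards [hae] with x hx
    have hx' : (x : E3) ≠ -p := fun h => hx (Subtype.ext h)
    exact (((tendsto_mob hp' (norm_eq_of_mem_sphere x) hx' hvlim).add halim).sub_const _).norm.pow 2
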